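/- Let p ≥ 1, α₁ > 1/p, α₂ > d/p, R > 0 and f ∈ C([0,1] × B̄(0,R)) (B̄(0,R) ⊂ ℝ^d closed ball). Define the rectangular increment □_{(s,x)}f(t,y) = f(s,x) − f(s,y) − f(t,x) + f(t,y). Then there is a constant C = C(d,α₁,α₂,p) such that for all s,t ∈ [0,1] and x,y ∈ B̄(0,R): |□_{(s,x)} f(t,y)|^p ≤ C · κ_f · |s−t|^{α₁p−1} |x−y|^{α₂p−d}, where κ_f = ∫_{[0,1]²×B̄(0,R)²} |□_{(u,z)}f(v,w)|^p / (|u−v|^{α₁p+1}|z−w|^{α₂p+d}) du dv dz dw. -/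

import Mathlib

open MeasureTheory
open scoped ENNReal

section helpers
variable {E : Type*} [NormedAddCommGroup E] [NormedSpace ℝ E] [FiniteDimensional ℝ E]
  [MeasurableSpace E] [BorelSpace E]

theorem aux_ball (c x : E) (R r : ℝ) (hR : 0 < R) (hr : 0 ≤ r) (hrR : r ≤ 2 * R)
    (hx : x ∈ Metric.closedBall c R) :
    ∃ x', Metric.closedBall x' (r / 2) ⊆ Metric.closedBall c R ∧
      Metric.closedBall x' (r / 2) ⊆ Metric.closedBall x r := by
  have hx' : ‖x - c‖ ≤ R := by simpa [dist_eq_norm] using hx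
  have h1 : r / (2 * R) ≤ 1 := by rw [div_le_one (by positivity)]; exact hrR
  have h0 : 0 ≤ r / (2 * R) := by positivity
  have h2 : r / (2 * R) * R = r / 2 := by field_simp
  refine ⟨x - (r / (2 * R)) • (x - c), ?_, ?_⟩
  · apply Metric.closedBall_subset_closedBall'
    have : x - (r / (2 * R)) • (x - c) - c = (1 - r / (2 * R)) • (x - c) := by
      rw [sub_smul, one_smul]; abel
    rw [dist_eq_norm, this, norm_smul, Real.norm_of_nonneg (by linarith)]
    nlinarith
  · apply Metric.closedBall_subset_closedBall'
    rw [dist_eq_norm]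
    have : x - (r / (2 * R)) • (x - c) - x = -((r / (2 * R)) • (x - c)) := by abel
    rw [this, norm_neg, norm_smul, Real.norm_of_nonneg h0]
    nlinarith

theorem aux_jensen (μ : Measure E) (A : Set E) (hA : IsCompact A) (h0 : μ A ≠ 0) (ht : μ A ≠ ⊤)
    (h : E → ℝ) (hc : ContinuousOn h A) (p : ℝ) (hp : 1 ≤ p) (b : ℝ) :
    ENNReal.ofReal (|(⨍ z in A, h z ∂μ) - b| ^ p) ≤
      (μ A)⁻¹ * ∫⁻ z in A, ENNReal.ofReal (|h z - b| ^ p) ∂μ := by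
  have hcont : Continuous fun t : ℝ => |t - b| ^ p :=
    (continuous_id.sub continuous_const).abs.rpow_const (fun _ => Or.inr (by linarith))
  have hconv : ConvexOn ℝ Set.univ fun t : ℝ => |t - b| ^ p := by
    have h1 : ConvexOn ℝ Set.univ fun t : ℝ => |t - b| := by
      refine ⟨convex_univ, fun x _ y _ a c ha hc' hac => ?_⟩
      simp only [smul_eq_mul]
      have : a * x + c * y - b = a * (x - b) + c * (y - b) := by
        have : b = (a + c) * b := by rw [hac, one_mul]
        linear_combination (-1 : ℝ) * this
      rw [this]
      refine (abs_add_le _ _).trans ?_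
      rw [abs_mul, abs_mul, abs_of_nonneg ha, abs_of_nonneg hc']
    refine ⟨convex_univ, fun x _ y _ a c ha hc' hac => ?_⟩
    refine (Real.rpow_le_rpow (abs_nonneg _) (h1.2 (Set.mem_univ x) (Set.mem_univ y) ha hc' hac)
      (by linarith)).trans ?_
    exact (convexOn_rpow hp).2 (abs_nonneg (x - b)) (abs_nonneg (y - b)) ha hc' hac
  have hfi : IntegrableOn h A μ :=
    ContinuousOn.integrableOn_of_subset_isCompact hc hA hA.measurableSet subset_rfl ht
  have hgc : ContinuousOn (fun z => |h z - b| ^ p) A := hcont.comp_continuousOn hc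
  have hgi : IntegrableOn (fun z => |h z - b| ^ p) A μ :=
    ContinuousOn.integrableOn_of_subset_isCompact hgc hA hA.measurableSet subset_rfl ht
  have key := hconv.map_set_average_le hcont.continuousOn isClosed_univ h0 ht (f := h)
    (by simp) hfi hgi
  refine (ENNReal.ofReal_le_ofReal key).trans ?_
  rw [← ofReal_integral_eq_lintegral_ofReal hgi (ae_of_all _ fun z => by positivity)]
  rw [setAverage_eq, smul_eq_mul, ENNReal.ofReal_mul (by positivity)]
  gcongr
  rw [Measure.real, ENNReal.ofReal_inv_of_pos (ENNReal.toReal_pos h0 ht), ENNReal.ofReal_toReal ht]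

theorem aux_two (μ : Measure E) (A B K : Set E) (hA : IsCompact A) (hA0 : μ A ≠ 0) (hAt : μ A ≠ ⊤)
    (hB : IsCompact B) (hB0 : μ B ≠ 0) (hBt : μ B ≠ ⊤) (hAK : A ⊆ K) (hBK : B ⊆ K)
    (h : E → ℝ) (hc : ContinuousOn h K) (p q D : ℝ) (hp : 1 ≤ p) (hq : 0 ≤ q)
    (hD : ∀ z ∈ A, ∀ w ∈ B, ‖z - w‖ ≤ D) :
    ENNReal.ofReal (|(⨍ z in A, h z ∂μ) - ⨍ z in B, h z ∂μ| ^ p) ≤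
      (μ A)⁻¹ * (μ B)⁻¹ * ENNReal.ofReal (D ^ q) *
        ∫⁻ z in K, ∫⁻ w in K, ENNReal.ofReal (|h z - h w| ^ p) /
          ENNReal.ofReal (‖z - w‖ ^ q) ∂μ ∂μ := by
  refine (aux_jensen μ A hA hA0 hAt h (hc.mono hAK) p hp _).trans ?_
  have hAi : (μ A)⁻¹ ≠ ⊤ := ENNReal.inv_ne_top.2 hA0
  have hBi : (μ B)⁻¹ ≠ ⊤ := ENNReal.inv_ne_top.2 hB0
  have hpt : ∀ z ∈ A, ∀ w ∈ B, ENNReal.ofReal (|h w - h z| ^ p) ≤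
      ENNReal.ofReal (D ^ q) * (ENNReal.ofReal (|h z - h w| ^ p) /
          ENNReal.ofReal (‖z - w‖ ^ q)) := by
    intro z hz w hw
    rw [abs_sub_comm]
    rcases eq_or_ne z w with rfl | hzw
    · simp [Real.zero_rpow (by linarith : p ≠ 0)]
    have hpos : 0 < ‖z - w‖ ^ q := Real.rpow_pos_of_pos (norm_pos_iff.2 (sub_ne_zero.2 hzw)) _
    have hle : ‖z - w‖ ^ q ≤ D ^ q := Real.rpow_le_rpow (norm_nonneg _) (hD z hz w hw) hq
    rw [← ENNReal.ofReal_div_of_pos hpos, ← ENNReal.ofReal_mul (hpos.le.trans hle)]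
    apply ENNReal.ofReal_le_ofReal
    rw [← mul_div_assoc, le_div_iff₀ hpos, mul_comm]
    gcongr
  have h1 : ∀ z ∈ A, ENNReal.ofReal (|h z - ⨍ w in B, h w ∂μ| ^ p) ≤
      (μ B)⁻¹ * (ENNReal.ofReal (D ^ q) * ∫⁻ w in K, ENNReal.ofReal (|h z - h w| ^ p) /
          ENNReal.ofReal (‖z - w‖ ^ q) ∂μ) := by
    intro z hz
    rw [abs_sub_comm]
    refine (aux_jensen μ B hB hB0 hBt h (hc.mono hBK) p hp _).trans ?_
    gcongr
    rw [← lintegral_const_mul' _ _ ENNReal.ofReal_ne_top]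
    refine (setLIntegral_mono' hB.measurableSet (hpt z hz)).trans ?_
    exact lintegral_mono_set hBK
  rw [mul_assoc, mul_assoc]
  gcongr
  rw [← lintegral_const_mul' _ _ ENNReal.ofReal_ne_top, ← lintegral_const_mul' _ _ hBi]
  refine (setLIntegral_mono' hA.measurableSet h1).trans ?_
  exact lintegral_mono_set hAK

theorem aux_tendsto (μ : Measure E) (K : Set E) (B : ℕ → Set E) (hB : ∀ k, IsCompact (B k))
    (hB0 : ∀ k, μ (B k) ≠ 0) (hBt : ∀ k, μ (B k) ≠ ⊤) (hBK : ∀ k, B k ⊆ K) (x : E) (hx : x ∈ K)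
    (r : ℕ → ℝ) (hr : Filter.Tendsto r Filter.atTop (nhds 0))
    (hBr : ∀ k, B k ⊆ Metric.closedBall x (r k)) (h : E → ℝ) (hc : ContinuousOn h K) :
    Filter.Tendsto (fun k => ⨍ z in B k, h z ∂μ) Filter.atTop (nhds (h x)) := by
  rw [Metric.nhds_basis_closedBall.tendsto_right_iff]
  intro ε hε
  obtain ⟨δ, hδ, hd⟩ := Metric.continuousWithinAt_iff.1 (hc x hx) ε hε
  filter_upwards [hr.eventually (gt_mem_nhds hδ)] with k hk
  refine (convex_closedBall (h x) ε).set_average_mem Metric.isClosed_closedBall (hB0 k) (hBt k) ?_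
    (ContinuousOn.integrableOn_of_subset_isCompact (hc.mono (hBK k)) (hB k)
      (hB k).measurableSet subset_rfl (hBt k))
  refine ae_restrict_of_forall_mem (hB k).measurableSet fun z hz => ?_
  exact (hd (hBK k hz) (lt_of_le_of_lt (hBr k hz) hk)).le

theorem aux_grr (μ : Measure E) [μ.IsAddHaarMeasure] (p α : ℝ) (hp : 1 ≤ p)
    (hα : (Module.finrank ℝ E : ℝ) / p < α) :
    ∃ C : ℝ, 0 < C ∧ ∀ (c : E) (R : ℝ), 0 < R → ∀ h : E → ℝ,
      ContinuousOn h (Metric.closedBall c R) →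
      ∀ x ∈ Metric.closedBall c R, ∀ y ∈ Metric.closedBall c R,
      ENNReal.ofReal (|h x - h y| ^ p) ≤
        ENNReal.ofReal C * ENNReal.ofReal (‖x - y‖ ^ (α * p - Module.finrank ℝ E)) *
        ∫⁻ z in Metric.closedBall c R, ∫⁻ w in Metric.closedBall c R,
          ENNReal.ofReal (|h z - h w| ^ p) /
          ENNReal.ofReal (‖z - w‖ ^ (α * p + Module.finrank ℝ E)) ∂μ ∂μ := by
  set n := Module.finrank ℝ E with hn
  have hp0 : 0 < p := by linarith
  set γ := α - n / p with hγ
  have hγ0 : 0 < γ := by simp only [hγ]; linarith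
  have hγp : γ * p = α * p - n := by simp only [hγ]; field_simp
  set q := α * p + n with hq
  have hα0 : 0 < α := lt_of_le_of_lt (by positivity) hα
  have hq0 : 0 ≤ q := by positivity
  have hV0 : μ (Metric.closedBall 0 1) ≠ 0 := (Metric.measure_closedBall_pos μ 0 one_pos).ne'
  have hVt : μ (Metric.closedBall 0 1) ≠ ⊤ := measure_closedBall_lt_top.ne
  set V := (μ (Metric.closedBall 0 1)).toReal with hV
  have hVp : 0 < V := ENNReal.toReal_pos hV0 hVt
  have hvol : ∀ (x : E) (r : ℝ), 0 < r → μ (Metric.closedBall x r) = ENNReal.ofReal (r ^ n * V) := by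
    intro x r hr
    rw [Measure.addHaar_closedBall' μ x hr.le, ENNReal.ofReal_mul (by positivity), hV,
      ENNReal.ofReal_toReal hVt]
  set M := (V ^ 2)⁻¹ * 8 ^ n * 3 ^ q with hM
  have hM0 : 0 < M := by positivity
  set θ : ℝ := (1 / 2 : ℝ) ^ γ with hθ
  have hθ0 : 0 < θ := by positivity
  have hθ1 : θ < 1 := Real.rpow_lt_one (by norm_num) (by norm_num) hγ0
  set L := 2 / (1 - θ) + 1 with hL
  have hL0 : 0 < L := by
    have : 0 < 1 - θ := by linarith
    positivity
  refine ⟨M * L ^ p, by positivity, ?_⟩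
  intro c R hR h hc x hx y hy
  set K := Metric.closedBall c R with hK
  set κ := ∫⁻ z in K, ∫⁻ w in K,
          ENNReal.ofReal (|h z - h w| ^ p) / ENNReal.ofReal (‖z - w‖ ^ q) ∂μ ∂μ with hκ
  rcases eq_or_ne x y with rfl | hxy
  · simp [Real.zero_rpow hp0.ne']
  set r := ‖x - y‖ with hr
  have hr0 : 0 < r := norm_pos_iff.2 (sub_ne_zero.2 hxy)
  have hrR : r ≤ 2 * R := by
    have h1 := Metric.mem_closedBall.1 hx
    have h2 := Metric.mem_closedBall.1 hy
    have := dist_triangle_right x y c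
    rw [dist_eq_norm x y] at this
    linarith
  rcases eq_or_ne κ ⊤ with hkt | hkt
  · rw [hkt, ENNReal.mul_top]
    · exact le_top
    · rw [← ENNReal.ofReal_mul (by positivity)]
      exact (ENNReal.ofReal_pos.2 (by positivity)).ne'
  set k := κ.toReal with hk
  have hk0 : 0 ≤ k := ENNReal.toReal_nonneg
  -- step estimate
  have step : ∀ (a b : E) (ρ σ : ℝ), 0 < ρ → ρ / 2 ≤ σ → Metric.closedBall a (ρ / 2) ⊆ K →
      Metric.closedBall b (σ / 2) ⊆ K →
      (∀ z ∈ Metric.closedBall a (ρ / 2), ∀ w ∈ Metric.closedBall b (σ / 2), ‖z - w‖ ≤ 3 * ρ) →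
      |(⨍ z in Metric.closedBall a (ρ / 2), h z ∂μ) - ⨍ z in Metric.closedBall b (σ / 2), h z ∂μ|
        ≤ (M * k) ^ (1 / p) * ρ ^ γ := by
    intro a b ρ σ hρ hσ haK hbK hD
    have hσ0 : 0 < σ := by linarith
    have := aux_two μ _ _ K (isCompact_closedBall a (ρ / 2))
      (Metric.measure_closedBall_pos μ a (by positivity)).ne' measure_closedBall_lt_top.ne
      (isCompact_closedBall b (σ / 2))
      (Metric.measure_closedBall_pos μ b (by positivity)).ne' measure_closedBall_lt_top.ne
      haK hbK h hc p q (3 * ρ) hp hq0 hD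
    rw [← hκ, ← ENNReal.ofReal_toReal hkt, ← hk, hvol _ _ (by positivity), hvol _ _ (by positivity),
      ← ENNReal.ofReal_inv_of_pos (by positivity), ← ENNReal.ofReal_inv_of_pos (by positivity),
      ← ENNReal.ofReal_mul (by positivity), ← ENNReal.ofReal_mul (by positivity),
      ← ENNReal.ofReal_mul (by positivity), ENNReal.ofReal_le_ofReal_iff (by positivity)] at this
    have h2 : |(⨍ z in Metric.closedBall a (ρ / 2), h z ∂μ) -
        ⨍ z in Metric.closedBall b (σ / 2), h z ∂μ| ^ p ≤ ((M * k) ^ (1 / p) * ρ ^ γ) ^ p := by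
      refine this.trans ?_
      have e3 : ((M * k) ^ (1 / p) * ρ ^ γ) ^ p = M * k * ρ ^ (α * p - n) := by
        rw [Real.mul_rpow (by positivity) (by positivity), ← Real.rpow_mul (by positivity),
          ← Real.rpow_mul (by positivity), one_div_mul_cancel hp0.ne', Real.rpow_one, hγp]
      rw [e3]
      calc ((ρ / 2) ^ n * V)⁻¹ * ((σ / 2) ^ n * V)⁻¹ * (3 * ρ) ^ q * k
          ≤ ((ρ / 2) ^ n * V)⁻¹ * ((ρ / 2 / 2) ^ n * V)⁻¹ * (3 * ρ) ^ q * k := by gcongr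
        _ = M * k * ρ ^ (α * p - n) := by
          have e1 : (3 * ρ) ^ q = 3 ^ q * (ρ ^ (α * p - n) * (ρ ^ n * ρ ^ n)) := by
            rw [Real.mul_rpow (by norm_num) hρ.le, ← Real.rpow_natCast, ← Real.rpow_add hρ,
              ← Real.rpow_add hρ]
            congr 2
            simp only [hq]; ring
          have e2 : (8 : ℝ) ^ n = 2 ^ n * 4 ^ n := by rw [← mul_pow]; norm_num
          rw [e1, hM, e2, div_div, div_pow, div_pow]
          norm_num
          field_simp
    exact (Real.rpow_le_rpow_iff (abs_nonneg _) (by positivity) hp0).1 h2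
  -- chaining
  have chain : ∀ x ∈ K, ∃ a, Metric.closedBall a (r / 2) ⊆ K ∧
      Metric.closedBall a (r / 2) ⊆ Metric.closedBall x r ∧
      |(⨍ z in Metric.closedBall a (r / 2), h z ∂μ) - h x| ≤
        (M * k) ^ (1 / p) * r ^ γ / (1 - θ) := by
    intro x hx
    have hρ : ∀ j : ℕ, 0 < r * (1 / 2) ^ j := fun j => by positivity
    have hρR : ∀ j : ℕ, r * (1 / 2) ^ j ≤ 2 * R := fun j => by
      have : (1 / 2 : ℝ) ^ j ≤ 1 := pow_le_one₀ (by norm_num) (by norm_num)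
      nlinarith
    choose a ha1 ha2 using fun j : ℕ => aux_ball c x R (r * (1 / 2) ^ j) hR (hρ j).le (hρR j) hx
    have ht := aux_tendsto μ K (fun j => Metric.closedBall (a j) (r * (1 / 2) ^ j / 2))
      (fun j => isCompact_closedBall _ _)
      (fun j => (Metric.measure_closedBall_pos μ _ (half_pos (hρ j))).ne')
      (fun j => measure_closedBall_lt_top.ne) ha1 x hx (fun j => r * (1 / 2) ^ j)
      (by simpa using (tendsto_pow_atTop_nhds_zero_of_lt_one (by norm_num : (0 : ℝ) ≤ 1 / 2)
            (by norm_num)).const_mul r) ha2 h hc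
    have hgeo := dist_le_of_le_geometric_of_tendsto₀ θ ((M * k) ^ (1 / p) * r ^ γ) hθ1 (fun j => by
      rw [Real.dist_eq]
      refine (step _ _ _ _ (hρ j) (le_of_eq (by rw [pow_succ]; ring)) (ha1 j) (ha1 (j + 1)) ?_).trans
        (le_of_eq ?_)
      · intro z hz w hw
        have h1 := Metric.mem_closedBall.1 (ha2 j hz)
        have h2 := Metric.mem_closedBall.1 (ha2 (j + 1) hw)
        have h3 := dist_triangle_right z w x
        have h4 := hρ j
        rw [pow_succ] at h2
        rw [← dist_eq_norm]
        linarith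
      · rw [Real.mul_rpow hr0.le (by positivity), hθ, ← Real.rpow_natCast, ← Real.rpow_natCast,
          ← Real.rpow_mul (by norm_num), ← Real.rpow_mul (by norm_num), mul_comm (j : ℝ) γ]
        ring) ht
    refine ⟨a 0, by simpa using ha1 0, by simpa using ha2 0, ?_⟩
    simpa [Real.dist_eq] using hgeo
  obtain ⟨a, haK, hax, ha⟩ := chain x hx
  obtain ⟨b, hbK, hby, hb⟩ := chain y hy
  have hab := step a b r r hr0 (by linarith) haK hbK (by
    intro z hz w hw
    have h1 := Metric.mem_closedBall.1 (hax hz)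
    have h2 := Metric.mem_closedBall.1 (hby hw)
    have h3 := dist_triangle4 z x y w
    rw [dist_comm y w, dist_eq_norm x y] at h3
    rw [← dist_eq_norm]
    linarith)
  have htot : |h x - h y| ≤ (M * k) ^ (1 / p) * r ^ γ * L := by
    have e : (M * k) ^ (1 / p) * r ^ γ * L = (M * k) ^ (1 / p) * r ^ γ / (1 - θ) +
      (M * k) ^ (1 / p) * r ^ γ + (M * k) ^ (1 / p) * r ^ γ / (1 - θ) := by rw [hL]; ring
    rw [e]
    rw [abs_le] at *
    constructor <;> linarith [ha.1, ha.2, hb.1, hb.2, hab.1, hab.2]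
  rw [← ENNReal.ofReal_toReal hkt, ← hk, ← ENNReal.ofReal_mul (by positivity),
    ← ENNReal.ofReal_mul (by positivity)]
  apply ENNReal.ofReal_le_ofReal
  refine (Real.rpow_le_rpow (abs_nonneg _) htot hp0.le).trans (le_of_eq ?_)
  rw [Real.mul_rpow (by positivity) hL0.le, Real.mul_rpow (by positivity) (by positivity),
    ← Real.rpow_mul (by positivity),
    ← Real.rpow_mul (by positivity), one_div_mul_cancel hp0.ne', Real.rpow_one, hγp]
  ring

end helpers



/-- **Two-parameter (time–space) Garsia–Rodemich–Rumsey inequality** for rectangular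
increments `□_{(s,x)}f(t,y) = f(s,x) − f(s,y) − f(t,x) + f(t,y)` of continuous functions
on `[0,1] × B̄(0,R) ⊆ [0,1] × ℝ^d`: there is `C = C(d,α₁,α₂,p)` with
`|□_{(s,x)}f(t,y)|^p ≤ C κ_f |s−t|^{α₁p−1} |x−y|^{α₂p−d}`. -/
theorem stmt16 {d : ℕ} (p α₁ α₂ : ℝ) (hp : 1 ≤ p) (hα₁ : 1 / p < α₁) (hα₂ : d / p < α₂) :
    ∃ C : ℝ≥0∞, 0 < C ∧ C ≠ ⊤ ∧
      ∀ R : ℝ, 0 < R →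
      ∀ f : ℝ → EuclideanSpace ℝ (Fin d) → ℝ,
        ContinuousOn (fun q : ℝ × EuclideanSpace ℝ (Fin d) => f q.1 q.2)
          (Set.Icc 0 1 ×ˢ Metric.closedBall 0 R) →
      ∀ s ∈ Set.Icc (0 : ℝ) 1, ∀ t ∈ Set.Icc (0 : ℝ) 1,
      ∀ x ∈ Metric.closedBall (0 : EuclideanSpace ℝ (Fin d)) R,
      ∀ y ∈ Metric.closedBall (0 : EuclideanSpace ℝ (Fin d)) R,
        ENNReal.ofReal (|f s x - f s y - f t x + f t y| ^ p)
          ≤ C *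
            (∫⁻ u in Set.Icc (0 : ℝ) 1, ∫⁻ v in Set.Icc (0 : ℝ) 1,
              ∫⁻ z in Metric.closedBall (0 : EuclideanSpace ℝ (Fin d)) R,
                ∫⁻ w in Metric.closedBall (0 : EuclideanSpace ℝ (Fin d)) R,
                  ENNReal.ofReal (|f u z - f u w - f v z + f v w| ^ p)
                    / ENNReal.ofReal
                        (|u - v| ^ (α₁ * p + 1) * ‖z - w‖ ^ (α₂ * p + d)))
            * ENNReal.ofReal (|s - t| ^ (α₁ * p - 1) * ‖x - y‖ ^ (α₂ * p - d)) := by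
  obtain ⟨C₁, hC₁, H₁⟩ := aux_grr (volume : Measure ℝ) p α₁ hp (by simpa using hα₁)
  obtain ⟨C₂, hC₂, H₂⟩ := aux_grr (volume : Measure (EuclideanSpace ℝ (Fin d))) p α₂ hp
    (by simpa using hα₂)
  simp only [Module.finrank_self, Nat.cast_one, finrank_euclideanSpace, Fintype.card_fin] at H₁ H₂
  have hp0 : p ≠ 0 := by linarith
  refine ⟨ENNReal.ofReal (C₁ * C₂), ENNReal.ofReal_pos.2 (by positivity), ENNReal.ofReal_ne_top, ?_⟩
  intro R hR f hf s hs t ht x hx y hy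
  have hI : Set.Icc (0 : ℝ) 1 = Metric.closedBall (1 / 2) (1 / 2) := by
    rw [Real.closedBall_eq_Icc]; norm_num
  have hfx : ∀ x ∈ Metric.closedBall (0 : EuclideanSpace ℝ (Fin d)) R,
      ContinuousOn (fun u => f u x) (Set.Icc 0 1) := fun x hx =>
    hf.comp (f := fun u : ℝ => (u, x)) (by fun_prop) (fun u hu => ⟨hu, hx⟩)
  have hfu : ∀ u ∈ Set.Icc (0 : ℝ) 1,
      ContinuousOn (fun x => f u x) (Metric.closedBall (0 : EuclideanSpace ℝ (Fin d)) R) :=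
    fun u hu => hf.comp (f := fun x : EuclideanSpace ℝ (Fin d) => (u, x)) (by fun_prop)
      (fun x hx => ⟨hu, hx⟩)
  have A := H₁ (1 / 2) (1 / 2) (by norm_num) (fun u => f u x - f u y)
    (by rw [← hI]; exact (hfx x hx).sub (hfx y hy)) s (hI ▸ hs) t (hI ▸ ht)
  rw [← hI] at A
  have e0 : f s x - f s y - f t x + f t y = (f s x - f s y) - (f t x - f t y) := by ring
  rw [e0]
  refine A.trans ?_
  set G : ℝ → ℝ → ℝ≥0∞ := fun u v => ∫⁻ z in Metric.closedBall (0 : EuclideanSpace ℝ (Fin d)) R,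
                ∫⁻ w in Metric.closedBall (0 : EuclideanSpace ℝ (Fin d)) R,
                  ENNReal.ofReal (|f u z - f u w - f v z + f v w| ^ p)
                    / ENNReal.ofReal
                        (|u - v| ^ (α₁ * p + 1) * ‖z - w‖ ^ (α₂ * p + d)) with hG
  have B : ∀ u ∈ Set.Icc (0 : ℝ) 1, ∀ v ∈ Set.Icc (0 : ℝ) 1,
      ENNReal.ofReal (|(f u x - f u y) - (f v x - f v y)| ^ p) /
        ENNReal.ofReal (‖u - v‖ ^ (α₁ * p + 1)) ≤
      ENNReal.ofReal C₂ * ENNReal.ofReal (‖x - y‖ ^ (α₂ * p - d)) * G u v := by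
    intro u hu v hv
    rcases eq_or_ne u v with rfl | huv
    · simp [Real.zero_rpow hp0]
    have hpos : 0 < |u - v| ^ (α₁ * p + 1) :=
      Real.rpow_pos_of_pos (abs_pos.2 (sub_ne_zero.2 huv)) _
    have h2 := H₂ 0 R hR (fun z => f u z - f v z) ((hfu u hu).sub (hfu v hv)) x hx y hy
    have e1 : (f u x - f u y) - (f v x - f v y) = (f u x - f v x) - (f u y - f v y) := by ring
    rw [e1, Real.norm_eq_abs, ENNReal.div_eq_inv_mul]
    have hit : (ENNReal.ofReal (|u - v| ^ (α₁ * p + 1)))⁻¹ ≠ ⊤ :=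
      ENNReal.inv_ne_top.2 (ENNReal.ofReal_pos.2 hpos).ne'
    refine (mul_le_mul_right h2 _).trans (le_of_eq ?_)
    rw [mul_left_comm, ← lintegral_const_mul' _ _ hit]
    congr 1
    refine lintegral_congr fun z => ?_
    rw [← lintegral_const_mul' _ _ hit]
    refine lintegral_congr fun w => ?_
    have e2 : f u z - f u w - f v z + f v w = (f u z - f v z) - (f u w - f v w) := by ring
    rw [e2, ENNReal.ofReal_mul hpos.le, ENNReal.div_eq_inv_mul, ENNReal.div_eq_inv_mul,
      ENNReal.mul_inv (Or.inl (ENNReal.ofReal_pos.2 hpos).ne') (Or.inl ENNReal.ofReal_ne_top),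
      mul_assoc]
  have hct : ENNReal.ofReal C₂ * ENNReal.ofReal (‖x - y‖ ^ (α₂ * p - d)) ≠ ⊤ :=
    ENNReal.mul_ne_top ENNReal.ofReal_ne_top ENNReal.ofReal_ne_top
  have D : (∫⁻ u in Set.Icc (0 : ℝ) 1, ∫⁻ v in Set.Icc (0 : ℝ) 1,
      ENNReal.ofReal (|(f u x - f u y) - (f v x - f v y)| ^ p) /
        ENNReal.ofReal (‖u - v‖ ^ (α₁ * p + 1))) ≤
      ENNReal.ofReal C₂ * ENNReal.ofReal (‖x - y‖ ^ (α₂ * p - d)) *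
      ∫⁻ u in Set.Icc (0 : ℝ) 1, ∫⁻ v in Set.Icc (0 : ℝ) 1, G u v := by
    rw [← lintegral_const_mul' _ _ hct]
    refine setLIntegral_mono' measurableSet_Icc fun u hu => ?_
    rw [← lintegral_const_mul' _ _ hct]
    exact setLIntegral_mono' measurableSet_Icc fun v hv => B u hu v hv
  refine (mul_le_mul_right D _).trans (le_of_eq ?_)
  rw [ENNReal.ofReal_mul hC₁.le, ENNReal.ofReal_mul (by positivity), Real.norm_eq_abs]
  ring
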